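/- Fix ε ∈ (0, 1/4). For n with ε ≤ x(n) ≤ 1/2 − ε, set r = r(n) = ⌊n^{x(n)/2}⌋ and n′ = n + r·a(n). Then f(n′) − f(n) = r + (1 − x(n) + o(1))·r/a(n); precisely, for every δ > 0 there is N such that for all n ≥ N with ε ≤ x(n) ≤ 1/2 − ε, | f(n′) − f(n) − r − (1 − x(n))·r/a(n) | ≤ δ·r/a(n). In particular, for n large enough in this range, f(n′) − f(n) > r + r/(2·a(n)). -/

import Mathlib

open Filter

/-- `f(n) = n / (2 log₂ n − 2 log₂ log₂ n − 2)`. -/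
noncomputable def f (n : ℕ) : ℝ :=
  n / (2 * Real.logb 2 n - 2 * Real.logb 2 (Real.logb 2 n) - 2)

/-- `α₀(n) = 2 log₂ n − 2 log₂ log₂ n + 2 log₂ (e/2) + 1`. -/
noncomputable def alpha0 (n : ℕ) : ℝ :=
  2 * Real.logb 2 n - 2 * Real.logb 2 (Real.logb 2 n)
    + 2 * Real.logb 2 (Real.exp 1 / 2) + 1

/-- `a(n) = ⌊α₀(n)⌋`. -/
noncomputable def aa (n : ℕ) : ℕ := ⌊alpha0 n⌋₊

/-- `μ(n) = C(n, a(n)) · 2^{−a(n)(a(n)−1)/2}`. -/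
noncomputable def mu (n : ℕ) : ℝ :=
  (n.choose (aa n) : ℝ) * (2 : ℝ)⁻¹ ^ ((aa n).choose 2)

/-- `x(n) = log μ(n) / log n`, so that `μ(n) = n^{x(n)}`. -/
noncomputable def xx (n : ℕ) : ℝ := Real.log (mu n) / Real.log n

open Topology

noncomputable def LL (n : ℕ) : ℝ := Real.logb 2 n
noncomputable def DD (n : ℕ) : ℝ :=
  2 * Real.logb 2 n - 2 * Real.logb 2 (Real.logb 2 n) - 2
noncomputable def th (n : ℕ) : ℝ := alpha0 n - aa n

lemma log2_pos : 0 < Real.log 2 := Real.log_pos (by norm_num)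

lemma LL_top : Tendsto LL atTop atTop :=
  (Real.tendsto_logb_atTop (by norm_num)).comp tendsto_natCast_atTop_atTop

lemma LL_eq (n : ℕ) : LL n * Real.log 2 = Real.log n := by
  have := log2_pos
  unfold LL Real.logb; field_simp

lemma logb_div : Tendsto (fun x : ℝ => Real.logb 2 x / x) atTop (𝓝 0) := by
  have h := Real.isLittleO_log_id_atTop.tendsto_div_nhds_zero
  have h2 := h.div_const (Real.log 2)
  rw [zero_div] at h2
  refine h2.congr fun x => ?_
  simp only [Real.logb, id]; ring

lemma DD_div : Tendsto (fun n => DD n / LL n) atTop (𝓝 2) := by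
  have h1 := (logb_div.comp LL_top).const_mul 2
  have h2 := (tendsto_inv_atTop_zero.comp LL_top).const_mul 2
  have h := (tendsto_const_nhds (x := (2:ℝ))).sub (h1.add h2)
  norm_num at h
  refine h.congr' ?_
  filter_upwards [LL_top.eventually_gt_atTop 0] with n hn
  show _ = (2 * LL n - 2 * Real.logb 2 (LL n) - 2) / LL n
  field_simp; ring

lemma DD_top : Tendsto DD atTop atTop := by
  have := DD_div.pos_mul_atTop (by norm_num) LL_top
  refine this.congr' ?_
  filter_upwards [LL_top.eventually_gt_atTop 0] with n hn
  field_simp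

lemma alpha0_eq (n : ℕ) : alpha0 n = DD n + 1 + 2 / Real.log 2 := by
  have := log2_pos
  unfold alpha0 DD
  have : Real.logb 2 (Real.exp 1 / 2) = 1 / Real.log 2 - 1 := by
    unfold Real.logb
    rw [Real.log_div (Real.exp_pos 1).ne' (by norm_num), Real.log_exp]
    field_simp
  rw [this]; ring

lemma alpha0_top : Tendsto alpha0 atTop atTop := by
  have h := tendsto_atTop_add_const_right atTop (1 + 2 / Real.log 2) DD_top
  refine h.congr fun n => ?_
  rw [alpha0_eq]; ring

lemma aa_top : Tendsto aa atTop atTop := tendsto_nat_floor_atTop.comp alpha0_top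

lemma th_bd : ∀ᶠ n in atTop, 0 ≤ th n ∧ th n ≤ 1 := by
  filter_upwards [alpha0_top.eventually_ge_atTop 0] with n hn
  have h1 := Nat.floor_le hn
  have h2 := Nat.lt_floor_add_one (alpha0 n)
  unfold th aa
  constructor <;> linarith

lemma bdd_mul {l : Filter ℕ} {u v : ℕ → ℝ} (hv : ∀ᶠ n in l, 0 ≤ v n ∧ v n ≤ 1)
    (hu : Tendsto u l (𝓝 0)) : Tendsto (fun n => u n * v n) l (𝓝 0) := by
  have h := hu.abs
  rw [abs_zero] at h
  refine squeeze_zero_norm' ?_ h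
  filter_upwards [hv] with n hn
  rw [Real.norm_eq_abs, abs_mul, abs_of_nonneg hn.1]
  exact mul_le_of_le_one_right (abs_nonneg _) hn.2

lemma aa_eq (n : ℕ) : (aa n : ℝ) = DD n + 1 + 2 / Real.log 2 - th n := by
  unfold th; rw [← alpha0_eq]; ring

lemma aa_div_DD : Tendsto (fun n => (aa n : ℝ) / DD n) atTop (𝓝 1) := by
  have hi : Tendsto (fun n => (DD n)⁻¹) atTop (𝓝 0) := tendsto_inv_atTop_zero.comp DD_top
  have h := ((tendsto_const_nhds (x := (1:ℝ))).add (hi.const_mul (1 + 2 / Real.log 2))).sub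
    (bdd_mul th_bd hi)
  norm_num at h
  refine h.congr' ?_
  filter_upwards [DD_top.eventually_gt_atTop 0] with n hn
  rw [aa_eq]
  have := log2_pos
  field_simp
  ring

lemma aa_div_LL : Tendsto (fun n => (aa n : ℝ) / LL n) atTop (𝓝 2) := by
  have h := aa_div_DD.mul DD_div
  norm_num at h
  refine h.congr' ?_
  filter_upwards [DD_top.eventually_gt_atTop 0] with n hn
  field_simp

lemma LL_div_pow {p : ℝ} (hp : 0 < p) :
    Tendsto (fun n : ℕ => LL n / (n:ℝ) ^ p) atTop (𝓝 0) := by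
  have h := ((isLittleO_log_rpow_atTop hp).tendsto_div_nhds_zero.comp
    tendsto_natCast_atTop_atTop).div_const (Real.log 2)
  rw [zero_div] at h
  refine h.congr fun n => ?_
  simp only [LL, Real.logb, Function.comp]; ring

lemma aa_div_pow {p : ℝ} (hp : 0 < p) :
    Tendsto (fun n : ℕ => (aa n : ℝ) / (n:ℝ) ^ p) atTop (𝓝 0) := by
  have h := aa_div_LL.mul (LL_div_pow hp)
  rw [mul_zero] at h
  refine h.congr' ?_
  filter_upwards [LL_top.eventually_gt_atTop 0] with n hn
  field_simp

lemma fact_asymp : Tendsto (fun k : ℕ =>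
    (Real.log (k.factorial) - k * Real.log k + k) / k) atTop (𝓝 0) := by
  have hs : Tendsto (fun k : ℕ => Real.log (Stirling.stirlingSeq k)) atTop
      (𝓝 (Real.log (√Real.pi))) :=
    Stirling.tendsto_stirlingSeq_sqrt_pi.log (by positivity)
  have hk : Tendsto (fun k : ℕ => ((k:ℝ))⁻¹) atTop (𝓝 0) := tendsto_inv_atTop_nhds_zero_nat
  have hl : Tendsto (fun k : ℕ => Real.log k / (k:ℝ)) atTop (𝓝 0) :=
    Real.isLittleO_log_id_atTop.tendsto_div_nhds_zero.comp tendsto_natCast_atTop_atTop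
  have h := ((hs.mul hk).add (hk.const_mul (1/2 * Real.log 2))).add (hl.const_mul (1/2))
  simp only [mul_zero, add_zero] at h
  refine h.congr' ?_
  filter_upwards [eventually_gt_atTop 0] with k hk0
  have hkp : (0:ℝ) < k := by exact_mod_cast hk0
  rw [Stirling.log_stirlingSeq_formula, Real.log_div hkp.ne' (Real.exp_pos 1).ne', Real.log_exp,
    Real.log_mul (by norm_num) hkp.ne']
  field_simp; ring

lemma desc_asymp : Tendsto (fun n : ℕ =>
    (Real.log (n.descFactorial (aa n)) - aa n * Real.log n) / LL n) atTop (𝓝 0) := by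
  have h1 : Tendsto (fun n : ℕ => (aa n : ℝ) / n) atTop (𝓝 0) := by
    simpa using aa_div_pow (p := 1) one_pos
  have h := (aa_div_LL.mul h1).const_mul 2
  simp only [mul_zero] at h
  refine squeeze_zero_norm' ?_ h
  filter_upwards [LL_top.eventually_gt_atTop 0, eventually_gt_atTop 0,
    h1.eventually_le_const (show (0:ℝ) < 1/2 by norm_num)] with n hL hn ha
  have hnp : (0:ℝ) < n := by exact_mod_cast hn
  rw [div_le_iff₀ hnp] at ha
  have han : aa n ≤ n := by
    have : (aa n : ℝ) ≤ n := by linarith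
    exact_mod_cast this
  have hcast : ((n + 1 - aa n : ℕ) : ℝ) = n + 1 - aa n := by
    rw [Nat.cast_sub (by omega)]; push_cast; ring
  have hmp : (0:ℝ) < n + 1 - aa n := by linarith
  have hup : ((n.descFactorial (aa n) : ℕ) : ℝ) ≤ (n:ℝ) ^ (aa n) := by
    exact_mod_cast Nat.descFactorial_le_pow n (aa n)
  have hlo : ((n:ℝ) + 1 - aa n) ^ (aa n) ≤ ((n.descFactorial (aa n) : ℕ) : ℝ) := by
    rw [← hcast]; exact_mod_cast Nat.pow_sub_le_descFactorial n (aa n)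
  have hlo0 : (0:ℝ) < ((n:ℝ) + 1 - aa n) ^ (aa n) := by positivity
  have hup' := Real.log_le_log (hlo0.trans_le hlo) hup
  have hlo' := Real.log_le_log hlo0 hlo
  rw [Real.log_pow] at hup' hlo'
  have hr := Real.one_sub_inv_le_log_of_pos (div_pos hmp hnp)
  rw [Real.log_div hmp.ne' hnp.ne', inv_div] at hr
  have hq : (n:ℝ) / (n + 1 - aa n) ≤ 1 + 2 * (aa n / n) := by
    rw [div_le_iff₀ hmp]
    have : (0:ℝ) ≤ aa n := by positivity
    have e : (1 + 2 * ((aa n:ℝ) / n)) * (n + 1 - aa n) =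
      n + (1 + aa n + 2 * (aa n / n) * (1 - aa n)) := by field_simp; ring
    rw [e]
    have : (aa n : ℝ) * (aa n / n) ≤ aa n * (1/2) := by
      exact mul_le_mul_of_nonneg_left ((div_le_iff₀ hnp).2 ha) this
    have : (0:ℝ) ≤ aa n / n := by positivity
    linarith
  rw [Real.norm_eq_abs, abs_div, abs_of_pos hL, abs_of_nonpos (by linarith), div_le_iff₀ hL]
  have : (aa n : ℝ) * (Real.log n - Real.log (n + 1 - aa n)) ≤ aa n * (2 * (aa n / n)) := by
    gcongr; linarith
  have e : 2 * ((aa n:ℝ) / LL n * (aa n / n)) * LL n = aa n * (2 * (aa n / n)) := by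
    field_simp
  rw [e]; linarith

lemma xx_th : Tendsto (fun n => xx n - th n) atTop (𝓝 0) := by
  have l2 := log2_pos
  have hL : Tendsto (fun n => (aa n : ℝ) / (2 * LL n)) atTop (𝓝 1) := by
    have h := aa_div_LL.div_const 2
    norm_num at h
    refine h.congr fun n => ?_
    rw [div_div, mul_comm]
  have hA := bdd_mul th_bd (by simpa using hL.sub_const 1)
  have hB := aa_div_LL.mul (hL.log (by norm_num))
  have hC := aa_div_LL.mul (fact_asymp.comp aa_top)
  have h := hA.add (((desc_asymp.sub hC).sub hB).div_const (Real.log 2))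
  simp only [Real.log_one, mul_zero, sub_zero, zero_div, add_zero] at h
  refine h.congr' ?_
  have h1 : Tendsto (fun n : ℕ => (aa n : ℝ) / n) atTop (𝓝 0) := by
    simpa using aa_div_pow (p := 1) one_pos
  filter_upwards [LL_top.eventually_gt_atTop 0, eventually_gt_atTop 0,
    h1.eventually_le_const (show (0:ℝ) < 1/2 by norm_num),
    aa_top.eventually_gt_atTop 0] with n hL hn ha ha0
  have hnp : (0:ℝ) < n := by exact_mod_cast hn
  have hap : (0:ℝ) < aa n := by exact_mod_cast ha0
  rw [div_le_iff₀ hnp] at ha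
  have han : aa n ≤ n := by
    have : (aa n : ℝ) ≤ n := by linarith
    exact_mod_cast this
  have hcp : (0:ℝ) < (n.choose (aa n) : ℝ) := by exact_mod_cast Nat.choose_pos han
  have hfp : (0:ℝ) < ((aa n).factorial : ℝ) := by exact_mod_cast Nat.factorial_pos _
  have hd : Real.log (n.descFactorial (aa n)) =
      Real.log ((aa n).factorial) + Real.log (n.choose (aa n)) := by
    rw [Nat.descFactorial_eq_factorial_mul_choose]
    push_cast
    rw [Real.log_mul hfp.ne' hcp.ne']
  have hmu : Real.log (mu n) = Real.log (n.choose (aa n))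
      - (aa n * (aa n - 1) / 2) * Real.log 2 := by
    unfold mu
    rw [Real.log_mul hcp.ne' (by positivity), Real.log_pow, Real.log_inv, Nat.cast_choose_two]
    ring
  have hlog : Real.log ((aa n:ℝ) / (2 * LL n)) = Real.log (aa n) - Real.log 2 - Real.log (LL n) := by
    rw [Real.log_div hap.ne' (by positivity), Real.log_mul (by norm_num) hL.ne']; ring
  have hth : th n * Real.log 2 =
      2 * LL n * Real.log 2 - 2 * Real.log (LL n) + 2 - Real.log 2 - aa n * Real.log 2 := by
    have := aa_eq n
    have e : DD n = 2 * LL n - 2 * (Real.log (LL n) / Real.log 2) - 2 := rfl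
    rw [e] at this
    have : th n = 2 * LL n - 2 * (Real.log (LL n) / Real.log 2) - 2 + 1 + 2 / Real.log 2 - aa n := by
      linarith
    rw [this]; field_simp; ring
  have hx : xx n = Real.log (mu n) / (LL n * Real.log 2) := by rw [LL_eq]; rfl
  simp only [Function.comp]
  rw [hx, hmu, hlog, hd, ← LL_eq n]
  have hth' : Real.log (LL n) = LL n * Real.log 2 + 1 - Real.log 2 / 2 - aa n * Real.log 2 / 2
    - th n * Real.log 2 / 2 := by linarith
  rw [hth']
  field_simp
  ring

noncomputable def rr (n : ℕ) : ℕ := ⌊(n : ℝ) ^ (xx n / 2)⌋₊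

def ff (ε : ℝ) : Filter ℕ := atTop ⊓ 𝓟 {n | ε ≤ xx n ∧ xx n ≤ 1/2 - ε}

noncomputable def GG (n : ℕ) : ℝ :=
  (f (n + rr n * aa n) - f n - rr n) * aa n / rr n - (1 - xx n)

lemma ff_le (ε : ℝ) : ff ε ≤ atTop := inf_le_left

lemma ff_mem (ε : ℝ) : ∀ᶠ n in ff ε, ε ≤ xx n ∧ xx n ≤ 1/2 - ε :=
  mem_inf_of_right (mem_principal_self _)

lemma ff_facts (ε : ℝ) (hε : 0 < ε) : ∀ᶠ n in ff ε, (0:ℝ) < rr n ∧ (0:ℝ) < aa n := by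
  filter_upwards [ff_mem ε, ff_le ε (eventually_gt_atTop 0),
    ff_le ε (aa_top.eventually_gt_atTop 0)] with n h hn ha
  refine ⟨?_, by exact_mod_cast ha⟩
  have : 0 < rr n := by
    unfold rr
    rw [Nat.floor_pos]
    exact Real.one_le_rpow (by exact_mod_cast hn) (by linarith [h.1])
  exact_mod_cast this

/-- relative increment -/
noncomputable def tt (n : ℕ) : ℝ := (rr n * aa n : ℝ) / n

lemma tt_lim (ε : ℝ) (hε : 0 < ε) : Tendsto tt (ff ε) (𝓝 0) := by
  have h := (aa_div_pow (p := 3/4) (by norm_num)).mono_left (ff_le ε)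
  refine squeeze_zero' ?_ ?_ h
  · exact Eventually.of_forall fun n => by unfold tt; positivity
  · filter_upwards [ff_mem ε, ff_le ε (eventually_gt_atTop 0)] with n h hn
    have hnp : (0:ℝ) < n := by exact_mod_cast hn
    have h1 : (rr n : ℝ) ≤ (n:ℝ) ^ (1/4 : ℝ) := by
      refine (Nat.floor_le (by positivity)).trans ?_
      exact Real.rpow_le_rpow_of_exponent_le (by exact_mod_cast hn) (by linarith [h.2])
    unfold tt
    have e : (n:ℝ) = (n:ℝ) ^ (1/4 : ℝ) * (n:ℝ) ^ (3/4 : ℝ) := by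
      rw [← Real.rpow_add hnp]; norm_num
    rw [div_le_div_iff₀ hnp (by positivity)]
    have : (rr n : ℝ) * (aa n * (n:ℝ) ^ (3/4 : ℝ)) ≤
      (n:ℝ) ^ (1/4 : ℝ) * (aa n * (n:ℝ) ^ (3/4 : ℝ)) := by gcongr
    calc _ = (rr n : ℝ) * (aa n * (n:ℝ) ^ (3/4 : ℝ)) := by ring
      _ ≤ _ := this
      _ = aa n * ((n:ℝ) ^ (1/4 : ℝ) * (n:ℝ) ^ (3/4 : ℝ)) := by ring
      _ = _ := by rw [← e]

noncomputable def eta (n : ℕ) : ℝ := DD (n + rr n * aa n) - DD n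

lemma eta_lim (ε : ℝ) (hε : 0 < ε) :
    Tendsto (fun n => eta n / tt n) (ff ε) (𝓝 (2 / Real.log 2)) := by
  have l2 := log2_pos
  have ht := tt_lim ε hε
  have hLi : Tendsto (fun n : ℕ => (Real.log (n:ℝ))⁻¹) (ff ε) (𝓝 0) :=
    (tendsto_inv_atTop_zero.comp
      (Real.tendsto_log_atTop.comp tendsto_natCast_atTop_atTop)).mono_left (ff_le ε)
  -- bounds: 2/log 2 * (1/(1+t) - 1/log n) ≤ eta/t ≤ 2/log 2
  have hlow : Tendsto (fun n => 2 / Real.log 2 * ((1 + tt n)⁻¹ - (Real.log (n:ℝ))⁻¹)) (ff ε)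
      (𝓝 (2 / Real.log 2)) := by
    have := (((ht.const_add 1).inv₀ (by norm_num)).sub hLi).const_mul (2 / Real.log 2)
    simpa using this
  have main : ∀ᶠ n in ff ε, 2 / Real.log 2 * ((1 + tt n)⁻¹ - (Real.log (n:ℝ))⁻¹) ≤ eta n / tt n ∧
      eta n / tt n ≤ 2 / Real.log 2 := by
    filter_upwards [ff_facts ε hε, ff_le ε (eventually_gt_atTop 1)] with n ⟨hr, ha⟩ hn
    have hn1 : (1:ℝ) < n := by exact_mod_cast hn
    have hnp : (0:ℝ) < n := by linarith
    have htp : 0 < tt n := by unfold tt; positivity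
    have hlp : 0 < Real.log n := Real.log_pos hn1
    have hcast : ((n + rr n * aa n : ℕ) : ℝ) = n * (1 + tt n) := by
      unfold tt; push_cast; field_simp
    set w := Real.log (1 + tt n) with hw
    have hw0 : 0 ≤ w := Real.log_nonneg (by linarith)
    have hwu : w ≤ tt n := by
      have := Real.log_le_sub_one_of_pos (show 0 < 1 + tt n by linarith)
      linarith
    have hwl : (1 + tt n)⁻¹ * tt n ≤ w := by
      have := Real.one_sub_inv_le_log_of_pos (show 0 < 1 + tt n by linarith)
      have e : (1 + tt n)⁻¹ * tt n = 1 - (1 + tt n)⁻¹ := by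
        have : 1 + tt n ≠ 0 := by linarith
        field_simp; ring
      rw [e]; exact this
    set z := Real.log (1 + w / Real.log n) with hz
    have hwd : 0 ≤ w / Real.log n := by positivity
    have hz0 : 0 ≤ z := Real.log_nonneg (by linarith)
    have hzu : z ≤ (Real.log n)⁻¹ * tt n := by
      have := Real.log_le_sub_one_of_pos (show 0 < 1 + w / Real.log n by linarith)
      have h2 : w / Real.log n ≤ tt n / Real.log n := by gcongr
      rw [inv_mul_eq_div]; linarith
    have he : eta n = 2 / Real.log 2 * (w - z) := by
      have e1 : Real.log ((n + rr n * aa n : ℕ) : ℝ) = Real.log n + w := by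
        rw [hcast, Real.log_mul hnp.ne' (by linarith)]
      have e2 : Real.log ((Real.log n + w) / Real.log 2) =
          Real.log (Real.log n / Real.log 2) + z := by
        have e3 : (Real.log n + w) / Real.log 2 =
            (Real.log n / Real.log 2) * (1 + w / Real.log n) := by field_simp
        rw [e3, Real.log_mul (by positivity) (by linarith)]
      unfold eta DD Real.logb
      rw [e1, e2]
      field_simp; ring
    have hc : 0 < 2 / Real.log 2 := by positivity
    rw [he]
    constructor
    · rw [le_div_iff₀ htp, mul_assoc]
      refine mul_le_mul_of_nonneg_left ?_ hc.le
      rw [sub_mul]; linarith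
    · rw [div_le_iff₀ htp]
      refine mul_le_mul_of_nonneg_left ?_ hc.le
      linarith
  exact tendsto_of_tendsto_of_tendsto_of_le_of_le' hlow tendsto_const_nhds
    (main.mono fun _ h => h.1) (main.mono fun _ h => h.2)

lemma key_tendsto (ε : ℝ) (hε : 0 < ε) : Tendsto GG (ff ε) (𝓝 0) := by
  have hq := eta_lim ε hε
  have ht := tt_lim ε hε
  have heta : Tendsto eta (ff ε) (𝓝 0) := by
    have h := hq.mul ht
    rw [mul_zero] at h
    refine h.congr' ?_
    filter_upwards [ff_facts ε hε, ff_le ε (eventually_gt_atTop 0)] with n ⟨hr, ha⟩ hn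
    have hnp : (0:ℝ) < n := by exact_mod_cast hn
    have : tt n ≠ 0 := by unfold tt; positivity
    field_simp
  have hD := DD_top.mono_left (ff_le ε)
  have hv := aa_div_DD.mono_left (ff_le ε)
  have hDi : Tendsto (fun n => (DD n)⁻¹) (ff ε) (𝓝 0) := tendsto_inv_atTop_zero.comp hD
  have hD'r : Tendsto (fun n => 1 + eta n * (DD n)⁻¹) (ff ε) (𝓝 1) := by
    simpa using (heta.mul hDi).const_add 1
  have hu : Tendsto (fun n => (aa n / DD n) / (1 + eta n * (DD n)⁻¹)) (ff ε) (𝓝 1) := by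
    have h := hv.div hD'r (by norm_num)
    rw [div_one] at h
    exact h
  have hb := bdd_mul ((th_bd).filter_mono (ff_le ε)) (by simpa using hu.sub_const 1)
  have h := ((((hu.mul_const (1 + 2 / Real.log 2)).sub (hu.mul heta)).sub
    (hq.mul (hu.mul hv))).sub_const 1).sub hb |>.add (xx_th.mono_left (ff_le ε))
  have e0 : (1 * (1 + 2 / Real.log 2) - 1 * 0 - 2 / Real.log 2 * (1 * 1) - 1 - 0 + 0 : ℝ) = 0 := by
    ring
  rw [e0] at h
  refine h.congr' ?_
  filter_upwards [ff_facts ε hε, ff_le ε (eventually_gt_atTop 0), hD.eventually_gt_atTop 0,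
    hD'r.eventually_const_lt (show (0:ℝ) < 1 by norm_num)] with n ⟨hr, ha⟩ hn hDp hDr
  have hnp : (0:ℝ) < n := by exact_mod_cast hn
  have hD' : DD (n + rr n * aa n) = DD n + eta n := by unfold eta; ring
  have hD'p : 0 < DD n + eta n := by
    have : DD n + eta n = DD n * (1 + eta n * (DD n)⁻¹) := by field_simp
    rw [this]; positivity
  have hf : ∀ m, f m = m / DD m := fun m => rfl
  have huu : (aa n / DD n) / (1 + eta n * (DD n)⁻¹) = aa n / (DD n + eta n) := by
    have : DD n + eta n = DD n * (1 + eta n * (DD n)⁻¹) := by field_simp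
    rw [this, div_div]
  have hth : th n = DD n + 1 + 2 / Real.log 2 - aa n := by rw [aa_eq]; ring
  unfold GG tt
  rw [huu, hf, hf, hD', hth]
  push_cast
  generalize 2 / Real.log 2 = c
  field_simp
  ring

/-- For `ε ≤ x(n) ≤ 1/2 − ε`, with `r = ⌊n^{x(n)/2}⌋` and `n′ = n + r·a(n)`:
`f(n′) − f(n) = r + (1 − x(n) + o(1))·r/a(n)`; in particular, for large such `n`,
`f(n′) − f(n) > r + r/(2 a(n))`. -/
theorem stmt15 (ε : ℝ) (hε : 0 < ε) (hε4 : ε < 1/4) :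
    (∀ δ > (0:ℝ), ∃ N : ℕ, ∀ n ≥ N, ε ≤ xx n → xx n ≤ 1/2 - ε →
      let r : ℕ := ⌊(n : ℝ) ^ (xx n / 2)⌋₊
      let n' : ℕ := n + r * aa n
      |f n' - f n - r - (1 - xx n) * r / aa n| ≤ δ * r / aa n) ∧
    (∃ N : ℕ, ∀ n ≥ N, ε ≤ xx n → xx n ≤ 1/2 - ε →
      let r : ℕ := ⌊(n : ℝ) ^ (xx n / 2)⌋₊
      let n' : ℕ := n + r * aa n
      f n' - f n > r + r / (2 * aa n)) := by
  have key : ∀ δ > (0:ℝ), ∃ N : ℕ, ∀ n ≥ N, ε ≤ xx n → xx n ≤ 1/2 - ε →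
      |f (n + rr n * aa n) - f n - rr n - (1 - xx n) * rr n / aa n| ≤ δ * rr n / aa n := by
    intro δ hδ
    have h := key_tendsto ε hε
    have h2 : ∀ᶠ n in ff ε, |GG n| ≤ δ := by
      have := h.abs
      rw [abs_zero] at this
      exact this.eventually_le_const hδ
    have h3 := h2.and (ff_facts ε hε)
    rw [ff, eventually_inf_principal, eventually_atTop] at h3
    obtain ⟨N, hN⟩ := h3
    refine ⟨N, fun n hn h1 h2 => ?_⟩
    obtain ⟨hG, hr, ha⟩ := hN n hn ⟨h1, h2⟩
    have e : f (n + rr n * aa n) - f n - rr n - (1 - xx n) * rr n / aa n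
        = GG n * (rr n / aa n) := by
      unfold GG; field_simp
    rw [e, abs_mul, abs_of_pos (div_pos hr ha), mul_div_assoc]
    exact mul_le_mul_of_nonneg_right hG (div_pos hr ha).le
  refine ⟨key, ?_⟩
  obtain ⟨N, hN⟩ := key (ε / 2) (by linarith)
  have h3 := ff_facts ε hε
  rw [ff, eventually_inf_principal, eventually_atTop] at h3
  obtain ⟨M, hM⟩ := h3
  refine ⟨max N M, fun n hn h1 h2 => ?_⟩
  have hA := hN n (le_of_max_le_left hn) h1 h2
  obtain ⟨hr, ha⟩ := hM n (le_of_max_le_right hn) ⟨h1, h2⟩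
  show f (n + rr n * aa n) - f n > rr n + rr n / (2 * aa n)
  have hA' := (abs_le.1 hA).1
  have hp : (0:ℝ) < rr n / aa n := div_pos hr ha
  have e1 : (rr n : ℝ) / (2 * aa n) = 1 / 2 * (rr n / aa n) := by field_simp
  rw [mul_div_assoc] at hA'
  rw [mul_div_assoc] at hA'
  rw [e1]
  nlinarith [mul_le_mul_of_nonneg_right h2 hp.le, mul_pos hε hp]
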